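/- Fix real constants a,b,c. Let T = q1⁴(q2−3q1)p1²/(q1−q2) + q2⁴(q1−3q2)p2²/(q2−q1), V = a(19q1⁴−68q1³q2+82q1²q2²−68q1q2³+19q2⁴)/(q1⁴q2⁴) + b q1²q2²/(q1+q2)² + c(q1−q2)²/(q1²q2²), K1 = q1²p1−q2²p2, K2 = q1q2(q1²p1+q2²p2)²/(q1−q2), U1 = −8a(3q1²−2q1q2+3q2²)(q1−q2)²/(q1⁴q2⁴) − c(q1−q2)²/(q1²q2²), U2 = −4a(q1+q2)²(q1−q2)/(q1³q2³) − b q1³q2³/((q1+q2)²(q1−q2)). Then H1 = T+V and H2 = (K1²+U1)(K2+U2)² satisfy {H1,H2} = 0 on the open set where q1,q2,q1−q2,q1+q2 are nonzero. -/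

import Mathlib

/-- Canonical Poisson bracket of two functions on phase space (q1,q2,p1,p2). -/
noncomputable def pb (f g : ℝ → ℝ → ℝ → ℝ → ℝ) (q1 q2 p1 p2 : ℝ) : ℝ :=
  (deriv (fun x => f x q2 p1 p2) q1) * (deriv (fun x => g q1 q2 x p2) p1)
  - (deriv (fun x => f q1 q2 x p2) p1) * (deriv (fun x => g x q2 p1 p2) q1)
  + (deriv (fun x => f q1 x p1 p2) q2) * (deriv (fun x => g q1 q2 p1 x) p2)
  - (deriv (fun x => f q1 q2 p1 x) p2) * (deriv (fun x => g q1 x p1 p2) q2)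

noncomputable def H1 (a b c q1 q2 p1 p2 : ℝ) : ℝ :=
  q1^4 * (q2 - 3*q1) * p1^2 / (q1 - q2) + q2^4 * (q1 - 3*q2) * p2^2 / (q2 - q1)
  + a * (19*q1^4 - 68*q1^3*q2 + 82*q1^2*q2^2 - 68*q1*q2^3 + 19*q2^4) / (q1^4*q2^4)
  + b * q1^2*q2^2 / (q1 + q2)^2 + c * (q1 - q2)^2 / (q1^2*q2^2)

noncomputable def H2 (a b c q1 q2 p1 p2 : ℝ) : ℝ :=
  ((q1^2*p1 - q2^2*p2)^2
    + (-8*a*(3*q1^2 - 2*q1*q2 + 3*q2^2)*(q1 - q2)^2/(q1^4*q2^4)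
        - c*(q1 - q2)^2/(q1^2*q2^2)))
  * (q1*q2*(q1^2*p1 + q2^2*p2)^2/(q1 - q2)
    + (-4*a*(q1 + q2)^2*(q1 - q2)/(q1^3*q2^3)
        - b*q1^3*q2^3/((q1 + q2)^2*(q1 - q2))))^2

/-- The factor `K1 ^ 2 + U1` of `H2`. -/
noncomputable def factorF (a c q1 q2 p1 p2 : ℝ) : ℝ :=
  (q1^2*p1 - q2^2*p2)^2
    + (-8*a*(3*q1^2 - 2*q1*q2 + 3*q2^2)*(q1 - q2)^2/(q1^4*q2^4)
        - c*(q1 - q2)^2/(q1^2*q2^2))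

/-- The factor `K2 + U2` of `H2`. -/
noncomputable def factorG (a b q1 q2 p1 p2 : ℝ) : ℝ :=
  q1*q2*(q1^2*p1 + q2^2*p2)^2/(q1 - q2)
    + (-4*a*(q1 + q2)^2*(q1 - q2)/(q1^3*q2^3)
        - b*q1^3*q2^3/((q1 + q2)^2*(q1 - q2)))

/-- The bracket `{h, f * g ^ 2}`, in terms of the partial derivatives of `h`, `f` and `g`. -/
theorem pb_mul_sq {h f g : ℝ → ℝ → ℝ → ℝ → ℝ} {q1 q2 p1 p2 : ℝ}
    {hq1 hq2 hp1 hp2 fq1 fq2 fp1 fp2 gq1 gq2 gp1 gp2 : ℝ}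
    (Hq1 : HasDerivAt (fun x => h x q2 p1 p2) hq1 q1)
    (Hq2 : HasDerivAt (fun x => h q1 x p1 p2) hq2 q2)
    (Hp1 : HasDerivAt (fun x => h q1 q2 x p2) hp1 p1)
    (Hp2 : HasDerivAt (fun x => h q1 q2 p1 x) hp2 p2)
    (Fq1 : HasDerivAt (fun x => f x q2 p1 p2) fq1 q1)
    (Fq2 : HasDerivAt (fun x => f q1 x p1 p2) fq2 q2)
    (Fp1 : HasDerivAt (fun x => f q1 q2 x p2) fp1 p1)
    (Fp2 : HasDerivAt (fun x => f q1 q2 p1 x) fp2 p2)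
    (Gq1 : HasDerivAt (fun x => g x q2 p1 p2) gq1 q1)
    (Gq2 : HasDerivAt (fun x => g q1 x p1 p2) gq2 q2)
    (Gp1 : HasDerivAt (fun x => g q1 q2 x p2) gp1 p1)
    (Gp2 : HasDerivAt (fun x => g q1 q2 p1 x) gp2 p2) :
    pb h (fun q1 q2 p1 p2 => f q1 q2 p1 p2 * g q1 q2 p1 p2 ^ 2) q1 q2 p1 p2 =
      g q1 q2 p1 p2 ^ 2 * (hq1 * fp1 - hp1 * fq1 + hq2 * fp2 - hp2 * fq2)
      + 2 * f q1 q2 p1 p2 * g q1 q2 p1 p2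
        * (hq1 * gp1 - hp1 * gq1 + hq2 * gp2 - hp2 * gq2) := by
  unfold pb
  rw [Hq1.deriv, Hq2.deriv, Hp1.deriv, Hp2.deriv, (Fq1.fun_mul (Gq1.fun_pow 2)).deriv,
    (Fq2.fun_mul (Gq2.fun_pow 2)).deriv, (Fp1.fun_mul (Gp1.fun_pow 2)).deriv,
    (Fp2.fun_mul (Gp2.fun_pow 2)).deriv]
  push_cast
  ring

section Derivatives

variable (a b c : ℝ) {x y : ℝ} (u v : ℝ)

theorem H1_swap (x y u v : ℝ) : H1 a b c x y u v = H1 a b c y x v u := by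
  unfold H1
  rw [add_comm y x]
  ring

theorem factorF_swap (x y u v : ℝ) : factorF a c x y u v = factorF a c y x v u := by
  unfold factorF
  ring

theorem factorG_swap (x y u v : ℝ) : factorG a b x y u v = -factorG a b y x v u := by
  unfold factorG
  rw [← neg_sub y x, add_comm y x]
  simp only [div_neg, mul_neg, neg_div]
  ring

theorem hasDerivAt_H1_position (hx : x ≠ 0) (hy : y ≠ 0) (h : x - y ≠ 0) (hs : x + y ≠ 0) :
    HasDerivAt (fun t => H1 a b c t y u v)
      (((4*x^3*y - 15*x^4)*(x - y) - x^4*(y - 3*x))*u^2/(x - y)^2 - 2*y^5*v^2/(x - y)^2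
        + a*(68*x^3*y - 164*x^2*y^2 + 204*x*y^3 - 76*y^4)/(x^5*y^4)
        + 2*b*x*y^3/(x + y)^3 + 2*c*(x - y)/(x^3*y)) x := by
  have h' : y - x ≠ 0 := by rwa [← neg_sub, neg_ne_zero]
  unfold H1
  eapply HasDerivAt.congr_deriv
  · repeat' with_reducible first
      | exact hasDerivAt_const _ _
      | exact hasDerivAt_id' _
      | eapply HasDerivAt.fun_add
      | eapply HasDerivAt.fun_sub
      | eapply HasDerivAt.fun_div
      | eapply HasDerivAt.fun_mul
      | eapply HasDerivAt.fun_pow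
    all_goals positivity
  · field_simp
    ring

theorem hasDerivAt_H1_momentum :
    HasDerivAt (fun t => H1 a b c x y t v)
      (2*x^4*(y - 3*x)*u/(x - y)) u := by
  unfold H1
  simp only [div_eq_mul_inv]
  eapply HasDerivAt.congr_deriv
  · repeat' with_reducible first
      | exact hasDerivAt_const _ _
      | exact hasDerivAt_id' _
      | eapply HasDerivAt.fun_add
      | eapply HasDerivAt.fun_sub
      | eapply HasDerivAt.fun_div
      | eapply HasDerivAt.fun_mul
      | eapply HasDerivAt.fun_pow
  · ring

theorem hasDerivAt_factorF_position (hx : x ≠ 0) (hy : y ≠ 0) :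
    HasDerivAt (fun t => factorF a c t y u v)
      (4*x*u*(x^2*u - y^2*v) - 8*a*(8*x^3*y - 20*x^2*y^2 + 24*x*y^3 - 12*y^4)/(x^5*y^4)
        - 2*c*(x - y)/(x^3*y)) x := by
  unfold factorF
  eapply HasDerivAt.congr_deriv
  · repeat' with_reducible first
      | exact hasDerivAt_const _ _
      | exact hasDerivAt_id' _
      | eapply HasDerivAt.fun_add
      | eapply HasDerivAt.fun_sub
      | eapply HasDerivAt.fun_div
      | eapply HasDerivAt.fun_mul
      | eapply HasDerivAt.fun_pow
    all_goals positivity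
  · field_simp
    ring

theorem hasDerivAt_factorF_momentum :
    HasDerivAt (fun t => factorF a c x y t v)
      (2*x^2*(x^2*u - y^2*v)) u := by
  unfold factorF
  simp only [div_eq_mul_inv]
  eapply HasDerivAt.congr_deriv
  · repeat' with_reducible first
      | exact hasDerivAt_const _ _
      | exact hasDerivAt_id' _
      | eapply HasDerivAt.fun_add
      | eapply HasDerivAt.fun_sub
      | eapply HasDerivAt.fun_div
      | eapply HasDerivAt.fun_mul
      | eapply HasDerivAt.fun_pow
  · ring

theorem hasDerivAt_factorG_position (hx : x ≠ 0) (hy : y ≠ 0) (h : x - y ≠ 0) (hs : x + y ≠ 0) :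
    HasDerivAt (fun t => factorG a b t y u v)
      (4*x^2*y*u*(x^2*u + y^2*v)/(x - y) - y^2*(x^2*u + y^2*v)^2/(x - y)^2
        - 4*a*(-x^2 + 2*x*y + 3*y^2)/(x^4*y^2) - b*x^2*y^4*(x - 3*y)/((x + y)^3*(x - y)^2)) x := by
  unfold factorG
  eapply HasDerivAt.congr_deriv
  · repeat' with_reducible first
      | exact hasDerivAt_const _ _
      | exact hasDerivAt_id' _
      | eapply HasDerivAt.fun_add
      | eapply HasDerivAt.fun_sub
      | eapply HasDerivAt.fun_div
      | eapply HasDerivAt.fun_mul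
      | eapply HasDerivAt.fun_pow
    all_goals positivity
  · field_simp
    ring

theorem hasDerivAt_factorG_momentum :
    HasDerivAt (fun t => factorG a b x y t v)
      (2*x^3*y*(x^2*u + y^2*v)/(x - y)) u := by
  unfold factorG
  simp only [div_eq_mul_inv]
  eapply HasDerivAt.congr_deriv
  · repeat' with_reducible first
      | exact hasDerivAt_const _ _
      | exact hasDerivAt_id' _
      | eapply HasDerivAt.fun_add
      | eapply HasDerivAt.fun_sub
      | eapply HasDerivAt.fun_div
      | eapply HasDerivAt.fun_mul
      | eapply HasDerivAt.fun_pow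
  · ring

end Derivatives

theorem stmt10 (a b c q1 q2 p1 p2 : ℝ) (h1 : q1 ≠ 0) (h2 : q2 ≠ 0)
    (h3 : q1 ≠ q2) (h4 : q1 + q2 ≠ 0) :
    pb (H1 a b c) (H2 a b c) q1 q2 p1 p2 = 0 := by
  have h : q1 - q2 ≠ 0 := sub_ne_zero.mpr h3
  have h' : q2 - q1 ≠ 0 := sub_ne_zero.mpr h3.symm
  have hs : q2 + q1 ≠ 0 := by rwa [add_comm]
  have Hq2 := hasDerivAt_H1_position a b c p2 p1 h2 h1 h' hs
  have Hp2 := hasDerivAt_H1_momentum a b c (x := q2) (y := q1) p2 p1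
  have Fq2 := hasDerivAt_factorF_position a c p2 p1 h2 h1
  have Fp2 := hasDerivAt_factorF_momentum a c (x := q2) (y := q1) p2 p1
  have Gq2 := (hasDerivAt_factorG_position a b p2 p1 h2 h1 h' hs).fun_neg
  have Gp2 := (hasDerivAt_factorG_momentum a b (x := q2) (y := q1) p2 p1).fun_neg
  simp only [← H1_swap a b c q1, ← factorF_swap a c q1, ← factorG_swap a b q1]
    at Hq2 Hp2 Fq2 Fp2 Gq2 Gp2
  refine (pb_mul_sq (hasDerivAt_H1_position a b c p1 p2 h1 h2 h h4) Hq2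
    (hasDerivAt_H1_momentum a b c p1 p2) Hp2
    (hasDerivAt_factorF_position a c p1 p2 h1 h2) Fq2
    (hasDerivAt_factorF_momentum a c p1 p2) Fp2
    (hasDerivAt_factorG_position a b p1 p2 h1 h2 h h4) Gq2
    (hasDerivAt_factorG_momentum a b p1 p2) Gp2).trans ?_
  rw [← neg_sub q1 q2, add_comm q2 q1]
  set r := 2*q1*q2*(q1 + q2)*(q1^2*p1 + q2^2*p2)/(q1 - q2)^2 with hr
  trans factorG a b q1 q2 p1 p2 ^ 2 * (2 * r * factorF a c q1 q2 p1 p2)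
    + 2 * factorF a c q1 q2 p1 p2 * factorG a b q1 q2 p1 p2 * (-r * factorG a b q1 q2 p1 p2)
  · congr 2
    · rw [hr]
      unfold factorF
      field_simp
      ring
    · rw [hr]
      unfold factorG
      field_simp
      ring
  · ring
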